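/- arXiv:1512.08862 — 7 statements merged into one kernel-verified Lean document; each statement's English description precedes it below -/
import Mathlib

section
/- Let q ∈ [0,1). For every integer k ≥ 0 one has (q;q)_∞ · ∑_{n=0}^∞ (q^n / (q;q)_n) · (q^n/(1-q))^k = [k]_q!. (Equivalently: the discrete measure D_{(1-q)^{-1/2}}(ρ_{-q,q}) = (q;q)_∞ ∑_{n=0}^∞ (q^n/(q;q)_n) δ_{(1-q)^{-1/2} q^{n/2}} has (2k)-th moment equal to the q-factorial [k]_q!, i.e. it is the radial part of the q-Gaussian Bargmann measure.) -/
/-- The q-Pochhammer symbol `(a;q)_k = ∏_{i=0}^{k-1} (1 - a q^i)`. -/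
noncomputable def qPoch (a q : ℝ) (k : ℕ) : ℝ :=
  ∏ i ∈ Finset.range k, (1 - a * q ^ i)

/-- The infinite q-Pochhammer symbol `(a;q)_∞ = ∏_{i=0}^{∞} (1 - a q^i)`. -/
noncomputable def qPochInf (a q : ℝ) : ℝ :=
  ∏' i : ℕ, (1 - a * q ^ i)

/-- The q-factorial `[k]_q! = ∏_{ℓ=1}^k (1 + q + ⋯ + q^{ℓ-1})`. -/
noncomputable def qFact (q : ℝ) (k : ℕ) : ℝ :=
  ∏ l ∈ Finset.range k, (∑ i ∈ Finset.range (l + 1), q ^ i)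

open Filter Topology in
/-- For `0 ≤ q < 1` the infinite product `(q;q)_∞` is the limit of `(q;q)_n`. -/
theorem tendsto_qPoch_qPochInf {q : ℝ} (h0 : 0 ≤ q) (h1 : q < 1) :
    Tendsto (qPoch q q) atTop (𝓝 (qPochInf q q)) := by
  have hs : Summable fun n : ℕ => ‖-(q * q ^ n)‖ := by
    simpa only [norm_neg] using ((summable_geometric_of_lt_one h0 h1).mul_left q).norm
  have hm : Multipliable fun n : ℕ => 1 - q * q ^ n := by
    simpa only [sub_eq_add_neg] using multipliable_one_add_of_summable hs
  exact hm.hasProd.tendsto_prod_nat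

theorem mul_pow_self_lt_one {q : ℝ} (h0 : 0 ≤ q) (h1 : q < 1) (n : ℕ) : q * q ^ n < 1 := by
  rw [← pow_succ']
  exact pow_lt_one₀ h0 h1 n.succ_ne_zero

theorem qPochInf_ne_zero {q : ℝ} (h0 : 0 ≤ q) (h1 : q < 1) : qPochInf q q ≠ 0 := by
  have hs : Summable fun n : ℕ => ‖-(q * q ^ n)‖ := by
    simpa only [norm_neg] using ((summable_geometric_of_lt_one h0 h1).mul_left q).norm
  have h := tprod_one_add_ne_zero_of_summable (f := fun n : ℕ => -(q * q ^ n))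
    (fun n => by simpa only [sub_eq_add_neg] using (sub_pos.2 (mul_pow_self_lt_one h0 h1 n)).ne') hs
  simpa only [qPochInf, sub_eq_add_neg] using h

theorem qPoch_pos {q : ℝ} (h0 : 0 ≤ q) (h1 : q < 1) (n : ℕ) : 0 < qPoch q q n :=
  Finset.prod_pos fun i _ => sub_pos.2 (mul_pow_self_lt_one h0 h1 i)

theorem qPoch_succ (a q : ℝ) (n : ℕ) : qPoch a q (n + 1) = qPoch a q n * (1 - a * q ^ n) :=
  Finset.prod_range_succ _ _

/-- The partial sums of `∑ q^n / (q;q)_n` telescope. -/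
theorem sum_range_pow_div_qPoch {q : ℝ} (h0 : 0 ≤ q) (h1 : q < 1) (n : ℕ) :
    ∑ i ∈ Finset.range (n + 1), q ^ i / qPoch q q i = (qPoch q q n)⁻¹ := by
  induction n with
  | zero => simp [qPoch]
  | succ n ih =>
    have hn := (qPoch_pos h0 h1 n).ne'
    have hq := (sub_pos.2 (mul_pow_self_lt_one h0 h1 n)).ne'
    rw [Finset.sum_range_succ, ih, qPoch_succ]
    field_simp
    ring

/-- Euler's identity `∑ q^n / (q;q)_n = 1 / (q;q)_∞`. -/
theorem hasSum_pow_div_qPoch {q : ℝ} (h0 : 0 ≤ q) (h1 : q < 1) :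
    HasSum (fun n : ℕ => q ^ n / qPoch q q n) (qPochInf q q)⁻¹ := by
  rw [hasSum_iff_tendsto_nat_of_nonneg
    (fun n => div_nonneg (pow_nonneg h0 n) (qPoch_pos h0 h1 n).le),
    ← Filter.tendsto_add_atTop_iff_nat 1]
  simp only [sum_range_pow_div_qPoch h0 h1]
  exact (tendsto_qPoch_qPochInf h0 h1).inv₀ (qPochInf_ne_zero h0 h1)

/-- Euler's identity `∑ z^n / (q;q)_n = 1 / (z;q)_∞` at `z = q^(k+1)`. -/
theorem hasSum_pow_div_qPoch_mul_pow {q : ℝ} (h0 : 0 ≤ q) (h1 : q < 1) (k : ℕ) :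
    HasSum (fun n : ℕ => q ^ n / qPoch q q n * (q ^ n) ^ k)
      ((qPochInf q q)⁻¹ * qPoch q q k) := by
  induction k with
  | zero => simpa [qPoch] using hasSum_pow_div_qPoch h0 h1
  | succ k ih =>
    have hshift : HasSum (fun n : ℕ => q ^ n / qPoch q q n * (q ^ n) ^ k * (1 - q ^ n))
        ((qPochInf q q)⁻¹ * qPoch q q k * (q * q ^ k)) := by
      rw [← hasSum_nat_add_iff' 1]
      simp only [Finset.sum_range_one, pow_zero, sub_self, mul_zero, sub_zero]
      refine (ih.mul_right (q * q ^ k)).congr_fun fun n => ?_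
      have hn := (qPoch_pos h0 h1 n).ne'
      have hq := (sub_pos.2 (mul_pow_self_lt_one h0 h1 n)).ne'
      rw [qPoch_succ, pow_succ' q n, mul_pow]
      field_simp
    rw [qPoch_succ, ← mul_assoc, mul_one_sub]
    exact (ih.sub hshift).congr_fun fun n => by ring

theorem qFact_eq_qPoch_div {q : ℝ} (h1 : q ≠ 1) (k : ℕ) :
    qFact q k = qPoch q q k / (1 - q) ^ k := by
  have hq : 1 - q ≠ 0 := sub_ne_zero.2 h1.symm
  induction k with
  | zero => simp [qFact, qPoch]
  | succ k ih =>
    rw [qFact, Finset.prod_range_succ, ← qFact, ih, qPoch_succ, ← pow_succ',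
      ← mul_neg_geom_sum]
    field_simp
    ring

/-- The (2k)-th moment of the radial q-Gaussian Bargmann measure
`D_{(1-q)^{-1/2}}(ρ_{-q,q}) = (q;q)_∞ ∑_n (q^n/(q;q)_n) δ_{(1-q)^{-1/2} q^{n/2}}`
equals the q-factorial `[k]_q!`. -/
theorem moments_of_radial_qGaussian (q : ℝ) (hq : q ∈ Set.Ico (0 : ℝ) 1) (k : ℕ) :
    qPochInf q q * ∑' n : ℕ, q ^ n / qPoch q q n * (q ^ n / (1 - q)) ^ k
      = qFact q k := by
  obtain ⟨h0, h1⟩ := hq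
  have h := (hasSum_pow_div_qPoch_mul_pow h0 h1 k).div_const ((1 - q) ^ k)
  simp only [div_pow, ← mul_div_assoc, h.tsum_eq]
  rw [mul_inv_cancel_left₀ (qPochInf_ne_zero h0 h1), qFact_eq_qPoch_div h1.ne]
end

section
/- Let q ∈ (-1,1) and let n ≥ 1 be an odd integer. Then for real x one has h_n(x|q) ≥ 0 if and only if x ≥ -1; moreover x = -1 is the unique real zero of h_n(·|q), i.e. h_n(x|q) = 0 with x ∈ ℝ implies x = -1. -/
/-- The q-binomial coefficient `[n choose l]_q = (q;q)_n / ((q;q)_l (q;q)_{n-l})`. -/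
noncomputable def qBinom (q : ℝ) (n l : ℕ) : ℝ :=
  qPoch q q n / (qPoch q q l * qPoch q q (n - l))

/-- The Rogers–Szegő polynomial `h_n(x|q) = ∑_{l=0}^n [n choose l]_q x^l`. -/
noncomputable def rogersSzego (q : ℝ) (n : ℕ) (x : ℝ) : ℝ :=
  ∑ l ∈ Finset.range (n + 1), qBinom q n l * x ^ l

theorem qPoch_self_succ (q : ℝ) (k : ℕ) :
    qPoch q q (k + 1) = qPoch q q k * (1 - q ^ (k + 1)) := by
  rw [qPoch, Finset.prod_range_succ, ← qPoch, pow_succ']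

theorem one_sub_pow_succ_pos {q : ℝ} (hq : q ∈ Set.Ioo (-1 : ℝ) 1) (k : ℕ) :
    0 < 1 - q ^ (k + 1) := by
  have h : |q ^ (k + 1)| < 1 := by
    rw [abs_pow]
    exact pow_lt_one₀ (abs_nonneg q) (abs_lt.2 hq) k.succ_ne_zero
  linarith [le_abs_self (q ^ (k + 1))]

theorem qPoch_self_pos {q : ℝ} (hq : q ∈ Set.Ioo (-1 : ℝ) 1) (k : ℕ) : 0 < qPoch q q k :=
  Finset.prod_pos fun i _ => by
    rw [← pow_succ']
    exact one_sub_pow_succ_pos hq i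

theorem qBinom_pos {q : ℝ} (hq : q ∈ Set.Ioo (-1 : ℝ) 1) (n l : ℕ) : 0 < qBinom q n l :=
  div_pos (qPoch_self_pos hq n) (mul_pos (qPoch_self_pos hq l) (qPoch_self_pos hq (n - l)))

theorem qBinom_zero_right {q : ℝ} (hq : q ∈ Set.Ioo (-1 : ℝ) 1) (n : ℕ) : qBinom q n 0 = 1 := by
  have h := (qPoch_self_pos hq n).ne'
  have h0 : qPoch q q 0 = 1 := by simp [qPoch]
  simp [qBinom, h0, h]

theorem qBinom_self {q : ℝ} (hq : q ∈ Set.Ioo (-1 : ℝ) 1) (n : ℕ) : qBinom q n n = 1 := by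
  have h := (qPoch_self_pos hq n).ne'
  have h0 : qPoch q q 0 = 1 := by simp [qPoch]
  simp [qBinom, h0, h]

/-- The absorption identity for `q`-binomial coefficients. -/
theorem one_sub_pow_mul_qBinom_succ_succ {q : ℝ} (hq : q ∈ Set.Ioo (-1 : ℝ) 1) (n l : ℕ) :
    (1 - q ^ (l + 1)) * qBinom q (n + 1) (l + 1) = (1 - q ^ (n + 1)) * qBinom q n l := by
  have h1 := (qPoch_self_pos hq l).ne'
  have h2 := (qPoch_self_pos hq (n - l)).ne'
  have h3 := (one_sub_pow_succ_pos hq l).ne'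
  rw [qBinom, qBinom, Nat.add_sub_add_right, qPoch_self_succ q n, qPoch_self_succ q l]
  field_simp

/-- The `q`-Pascal rule. -/
theorem qBinom_succ_succ {q : ℝ} (hq : q ∈ Set.Ioo (-1 : ℝ) 1) {n l : ℕ} (hl : l + 1 ≤ n) :
    qBinom q (n + 1) (l + 1) = qBinom q n l + q ^ (l + 1) * qBinom q n (l + 1) := by
  obtain ⟨k, rfl⟩ := Nat.exists_eq_add_of_le hl
  have h1 := (qPoch_self_pos hq l).ne'
  have h2 := (qPoch_self_pos hq k).ne'
  have h3 := (one_sub_pow_succ_pos hq l).ne'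
  have h4 := (one_sub_pow_succ_pos hq k).ne'
  have e1 : l + 1 + k + 1 - (l + 1) = k + 1 := by omega
  have e2 : l + 1 + k - l = k + 1 := by omega
  have e3 : l + 1 + k - (l + 1) = k := by omega
  rw [qBinom, qBinom, qBinom, e1, e2, e3, qPoch_self_succ q (l + 1 + k), qPoch_self_succ q l,
    qPoch_self_succ q k]
  field_simp
  ring

theorem rogersSzego_succ {q : ℝ} (hq : q ∈ Set.Ioo (-1 : ℝ) 1) (n : ℕ) (x : ℝ) :
    rogersSzego q (n + 1) x =
      x * rogersSzego q n x + ∑ l ∈ Finset.range (n + 1), q ^ l * qBinom q n l * x ^ l := by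
  have h : ∑ l ∈ Finset.range n, qBinom q (n + 1) (l + 1) * x ^ (l + 1) =
      x * ∑ l ∈ Finset.range n, qBinom q n l * x ^ l +
        ∑ l ∈ Finset.range n, q ^ (l + 1) * qBinom q n (l + 1) * x ^ (l + 1) := by
    rw [Finset.mul_sum, ← Finset.sum_add_distrib]
    refine Finset.sum_congr rfl fun l hl => ?_
    rw [qBinom_succ_succ hq (Finset.mem_range.1 hl)]
    ring
  rw [rogersSzego, Finset.sum_range_succ', Finset.sum_range_succ, h, rogersSzego,
    Finset.sum_range_succ (fun l => qBinom q n l * x ^ l),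
    Finset.sum_range_succ' (fun l => q ^ l * qBinom q n l * x ^ l)]
  simp only [qBinom_zero_right hq, qBinom_self hq]
  ring

theorem sum_one_sub_pow_mul_qBinom_succ {q : ℝ} (hq : q ∈ Set.Ioo (-1 : ℝ) 1) (n : ℕ) (x : ℝ) :
    ∑ l ∈ Finset.range (n + 2), (1 - q ^ l) * qBinom q (n + 1) l * x ^ l =
      (1 - q ^ (n + 1)) * x * rogersSzego q n x := by
  rw [Finset.sum_range_succ', rogersSzego, Finset.mul_sum]
  simp only [one_sub_pow_mul_qBinom_succ_succ hq, pow_zero, sub_self, zero_mul, add_zero]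
  exact Finset.sum_congr rfl fun l _ => by ring

/-- The three-term recurrence for Rogers–Szegő polynomials. -/
theorem rogersSzego_succ_succ {q : ℝ} (hq : q ∈ Set.Ioo (-1 : ℝ) 1) (n : ℕ) (x : ℝ) :
    rogersSzego q (n + 2) x =
      (1 + x) * rogersSzego q (n + 1) x - (1 - q ^ (n + 1)) * x * rogersSzego q n x := by
  rw [rogersSzego_succ hq, ← sum_one_sub_pow_mul_qBinom_succ hq]
  have h : ∑ l ∈ Finset.range (n + 2), (1 - q ^ l) * qBinom q (n + 1) l * x ^ l =
      rogersSzego q (n + 1) x -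
        ∑ l ∈ Finset.range (n + 2), q ^ l * qBinom q (n + 1) l * x ^ l := by
    rw [rogersSzego, ← Finset.sum_sub_distrib]
    exact Finset.sum_congr rfl fun l _ => by ring
  rw [h]
  ring

theorem rogersSzego_zero {q : ℝ} (hq : q ∈ Set.Ioo (-1 : ℝ) 1) (x : ℝ) :
    rogersSzego q 0 x = 1 := by
  simp [rogersSzego, qBinom_self hq]

theorem rogersSzego_one {q : ℝ} (hq : q ∈ Set.Ioo (-1 : ℝ) 1) (x : ℝ) :
    rogersSzego q 1 x = 1 + x := by
  simp [rogersSzego, Finset.sum_range_succ, qBinom_self hq, qBinom_zero_right hq]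

theorem rogersSzego_pos_of_nonneg {q : ℝ} (hq : q ∈ Set.Ioo (-1 : ℝ) 1) (n : ℕ) {x : ℝ}
    (hx : 0 ≤ x) : 0 < rogersSzego q n x := by
  rw [rogersSzego, Finset.sum_range_succ', qBinom_zero_right hq]
  have : 0 ≤ ∑ l ∈ Finset.range n, qBinom q n (l + 1) * x ^ (l + 1) :=
    Finset.sum_nonneg fun l _ => mul_nonneg (qBinom_pos hq n (l + 1)).le (pow_nonneg hx _)
  simpa using add_pos_of_nonneg_of_pos this one_pos

theorem rogersSzego_pos_of_neg_one_lt {q : ℝ} (hq : q ∈ Set.Ioo (-1 : ℝ) 1) (n : ℕ) {x : ℝ}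
    (hx : -1 < x) : 0 < rogersSzego q n x := by
  rcases le_or_gt 0 x with h0 | h0
  · exact rogersSzego_pos_of_nonneg hq n h0
  · induction n using Nat.twoStepInduction with
    | zero => simp [rogersSzego_zero hq]
    | one => rw [rogersSzego_one hq]; linarith
    | more n ih ih' =>
      have h1 := mul_pos (by linarith : 0 < 1 + x) ih'
      have h2 := mul_pos (mul_pos (one_sub_pow_succ_pos hq n) (neg_pos.2 h0)) ih
      rw [rogersSzego_succ_succ hq]
      linarith

theorem neg_one_pow_mul_rogersSzego_pos {q : ℝ} (hq : q ∈ Set.Ioo (-1 : ℝ) 1) (n : ℕ) {x : ℝ}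
    (hx : x < -1) : 0 < (-1) ^ n * rogersSzego q n x := by
  induction n using Nat.twoStepInduction with
  | zero => simp [rogersSzego_zero hq]
  | one => rw [rogersSzego_one hq]; linarith
  | more n ih ih' =>
    have h1 := mul_pos (by linarith : 0 < -(1 + x)) ih'
    have h2 := mul_pos (mul_pos (one_sub_pow_succ_pos hq n) (by linarith : 0 < -x)) ih
    rw [rogersSzego_succ_succ hq]
    refine (add_pos h1 h2).trans_eq ?_
    ring

theorem rogersSzego_neg_one {q : ℝ} (hq : q ∈ Set.Ioo (-1 : ℝ) 1) {n : ℕ} (hn : Odd n) :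
    rogersSzego q n (-1) = 0 := by
  obtain ⟨k, rfl⟩ := hn
  induction k with
  | zero => simp [rogersSzego_one hq]
  | succ k ih =>
    rw [show 2 * (k + 1) + 1 = 2 * k + 1 + 2 by ring, rogersSzego_succ_succ hq, ih]
    ring

/-- For odd `n ≥ 1`, `h_n(x|q) ≥ 0` iff `x ≥ -1`, and `x = -1` is the unique
real zero of `h_n(·|q)`. -/
theorem rogersSzego_odd_nonneg_iff (q : ℝ) (hq : q ∈ Set.Ioo (-1 : ℝ) 1)
    (n : ℕ) (hn : 1 ≤ n) (hodd : Odd n) :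
    (∀ x : ℝ, 0 ≤ rogersSzego q n x ↔ -1 ≤ x) ∧
    (∀ x : ℝ, rogersSzego q n x = 0 → x = -1) := by
  have hneg {x : ℝ} (hx : x < -1) : rogersSzego q n x < 0 := by
    have h := neg_one_pow_mul_rogersSzego_pos hq n hx
    rw [hodd.neg_one_pow] at h
    linarith
  refine ⟨fun x => ⟨fun h => not_lt.1 fun hx => (hneg hx).not_ge h, fun hx => ?_⟩, fun x h => ?_⟩
  · rcases hx.eq_or_lt with rfl | hx
    · exact (rogersSzego_neg_one hq hodd).ge
    · exact (rogersSzego_pos_of_neg_one_lt hq n hx).le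
  · rcases lt_trichotomy x (-1) with hx | hx | hx
    · exact absurd h (hneg hx).ne
    · exact hx
    · exact absurd h (rogersSzego_pos_of_neg_one_lt hq n hx).ne'
end

section
/- Let μ be a signed measure on ℝ with compact support (equivalently, μ = μ₁ - μ₂ for finite compactly supported nonnegative Borel measures μ₁, μ₂ on ℝ), and let ν be a nonnegative Borel measure on ℝ with all moments finite. If ∫ x^n μ(dx) = ∫ x^n ν(dx) for every integer n ≥ 0, then μ = ν (in particular ν is also compactly supported). -/
open MeasureTheory

open Filter Topology in
/-- A measure whose even moments grow at most like `C * M ^ (2 * n)` is carried by `[-M, M]`. -/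
lemma measure_lt_abs_eq_zero_of_moments_le {ν : Measure ℝ} {C M : ℝ} (hM : 0 ≤ M)
    (hν : ∀ n : ℕ, Integrable (fun x : ℝ => x ^ (2 * n)) ν)
    (hle : ∀ n : ℕ, ∫ x, x ^ (2 * n) ∂ν ≤ C * M ^ (2 * n)) :
    ν {x : ℝ | M < |x|} = 0 := by
  have : IsFiniteMeasure ν := by
    have h := hν 0
    simpa [integrable_const_iff] using h
  have key : ∀ r : ℝ, M < r → ν {x : ℝ | r ≤ |x|} = 0 := by
    intro r hr
    have hr0 : 0 < r := hM.trans_lt hr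
    have hbound : ∀ n : ℕ, ν.real {x : ℝ | r ≤ |x|} ≤ C * ((M / r) ^ 2) ^ n := by
      intro n
      have hmarkov := mul_meas_ge_le_integral_of_nonneg (μ := ν)
        (f := fun x : ℝ => x ^ (2 * n))
        (Eventually.of_forall fun x => (even_two_mul n).pow_nonneg x) (hν n) (r ^ (2 * n))
      have hsub : ν.real {x : ℝ | r ≤ |x|} ≤ ν.real {x : ℝ | r ^ (2 * n) ≤ x ^ (2 * n)} := by
        refine measureReal_mono fun x hx => ?_
        have hpow : r ^ (2 * n) ≤ |x| ^ (2 * n) := pow_le_pow_left₀ hr0.le hx _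
        rwa [(even_two_mul n).pow_abs] at hpow
      have hrn : 0 < r ^ (2 * n) := by positivity
      rw [← pow_mul, div_pow, mul_div_assoc', le_div_iff₀ hrn, mul_comm]
      exact (mul_le_mul_of_nonneg_left hsub hrn.le).trans (hmarkov.trans (hle n))
    have hlim : Tendsto (fun n : ℕ => C * ((M / r) ^ 2) ^ n) atTop (𝓝 0) := by
      have hlt : (M / r) ^ 2 < 1 :=
        pow_lt_one₀ (by positivity) ((div_lt_one hr0).2 hr) two_ne_zero
      simpa using (tendsto_pow_atTop_nhds_zero_of_lt_one (by positivity) hlt).const_mul C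
    exact (measureReal_eq_zero_iff).1
      (le_antisymm (ge_of_tendsto' hlim hbound) measureReal_nonneg)
  refine measure_mono_null (fun x (hx : M < |x|) => ?_)
    (measure_iUnion_null fun k : ℕ => key (M + 1 / ((k : ℝ) + 1))
      (lt_add_of_pos_right M Nat.one_div_pos_of_nat))
  obtain ⟨k, hk⟩ := exists_nat_one_div_lt (sub_pos.2 hx)
  exact Set.mem_iUnion.2 ⟨k, (lt_sub_iff_add_lt'.1 hk).le⟩

/-- A continuous function is integrable against a finite measure carried by `[-M, M]`. -/
lemma Continuous.integrable_of_ae_abs_le {μ : Measure ℝ} [IsFiniteMeasure μ] {M : ℝ}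
    (hμ : ∀ᵐ x ∂μ, |x| ≤ M) {f : ℝ → ℝ} (hf : Continuous f) : Integrable f μ := by
  obtain ⟨C, hC⟩ := (isCompact_Icc (a := -M) (b := M)).exists_bound_of_continuousOn hf.continuousOn
  exact Integrable.of_bound hf.aestronglyMeasurable C
    (hμ.mono fun x hx => hC x (abs_le.1 hx))

/-- Finite measures carried by a bounded interval are determined by their moments. -/
lemma MeasureTheory.Measure.eq_of_ae_abs_le_of_moments_eq {α β : Measure ℝ} [IsFiniteMeasure α]
    [IsFiniteMeasure β] {M : ℝ} (hα : ∀ᵐ x ∂α, |x| ≤ M) (hβ : ∀ᵐ x ∂β, |x| ≤ M)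
    (hmom : ∀ n : ℕ, ∫ x, x ^ n ∂α = ∫ x, x ^ n ∂β) : α = β := by
  have hpoly : ∀ p : Polynomial ℝ, ∫ x, p.eval x ∂α = ∫ x, p.eval x ∂β := by
    intro p
    have expand : ∀ γ : Measure ℝ, IsFiniteMeasure γ → (∀ᵐ x ∂γ, |x| ≤ M) →
        ∫ x, p.eval x ∂γ = ∑ i ∈ Finset.range (p.natDegree + 1), p.coeff i * ∫ x, x ^ i ∂γ := by
      intro γ _ hγ
      simp_rw [Polynomial.eval_eq_sum_range]
      rw [integral_finsetSum _ fun i _ =>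
        Continuous.integrable_of_ae_abs_le hγ (by fun_prop)]
      simp_rw [integral_const_mul]
    rw [expand α inferInstance hα, expand β inferInstance hβ]
    simp_rw [hmom]
  refine ext_of_forall_integral_eq_of_IsFiniteMeasure fun f => ?_
  have close : ∀ (γ : Measure ℝ) [IsFiniteMeasure γ], (∀ᵐ x ∂γ, |x| ≤ M) →
      ∀ (p : Polynomial ℝ) (ε : ℝ), (∀ x ∈ Set.Icc (-M) M, |p.eval x - f x| < ε) →
      |∫ x, p.eval x ∂γ - ∫ x, f x ∂γ| ≤ ε * γ.real Set.univ := by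
    intro γ _ hγ p ε hp
    rw [← integral_sub (Continuous.integrable_of_ae_abs_le hγ p.continuous)
      (Continuous.integrable_of_ae_abs_le hγ f.continuous), ← Real.norm_eq_abs]
    exact norm_integral_le_of_norm_le_const (hγ.mono fun x hx => (hp x (abs_le.1 hx)).le)
  set K := α.real Set.univ + β.real Set.univ + 1 with hK
  have hKpos : 0 < K := by positivity
  refine eq_of_forall_dist_le fun δ hδ => ?_
  obtain ⟨p, hp⟩ := exists_polynomial_near_of_continuousOn (-M) M f f.continuous.continuousOn
    (δ / K) (div_pos hδ hKpos)
  have h₁ := close α hα p _ hp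
  have h₂ := close β hβ p _ hp
  rw [← hpoly p] at h₂
  rw [Real.dist_eq]
  calc |∫ x, f x ∂α - ∫ x, f x ∂β|
      ≤ |∫ x, f x ∂α - ∫ x, p.eval x ∂α| + |∫ x, p.eval x ∂α - ∫ x, f x ∂β| :=
        abs_sub_le _ _ _
    _ ≤ δ / K * α.real Set.univ + δ / K * β.real Set.univ :=
        add_le_add ((abs_sub_comm _ _).trans_le h₁) h₂
    _ ≤ δ / K * K := by
        rw [← mul_add]
        exact mul_le_mul_of_nonneg_left (by rw [hK]; linarith) (by positivity)
    _ = δ := div_mul_cancel₀ _ hKpos.ne'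

/-- A compactly supported signed measure `μ = μ₁ - μ₂` and a nonnegative measure `ν`
with all moments finite that have the same moments of all orders are equal,
i.e. `μ₁ = ν + μ₂`. -/
theorem signed_measure_eq_of_moments_eq (μ₁ μ₂ ν : Measure ℝ)
    [IsFiniteMeasure μ₁] [IsFiniteMeasure μ₂]
    (hsupp : ∃ R : ℝ, μ₁ {x : ℝ | R < |x|} = 0 ∧ μ₂ {x : ℝ | R < |x|} = 0)
    (hν : ∀ n : ℕ, Integrable (fun x : ℝ => x ^ n) ν)
    (hmom : ∀ n : ℕ, (∫ x, x ^ n ∂μ₁) - (∫ x, x ^ n ∂μ₂) = ∫ x, x ^ n ∂ν) :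
    μ₁ = ν + μ₂ := by
  have : IsFiniteMeasure ν := by
    have h := hν 0
    simpa [integrable_const_iff] using h
  obtain ⟨R, hR₁, hR₂⟩ := hsupp
  have carried : ∀ γ : Measure ℝ, γ {x : ℝ | R < |x|} = 0 → ∀ᵐ x ∂γ, |x| ≤ max R 0 := by
    intro γ hγ
    have hae : ∀ᵐ x ∂γ, ¬ R < |x| := by simpa [ae_iff] using hγ
    exact hae.mono fun x hx => (not_lt.1 hx).trans (le_max_left _ _)
  have h₁ := carried μ₁ hR₁
  have h₂ := carried μ₂ hR₂
  have hν_null : ν {x : ℝ | max R 0 < |x|} = 0 := by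
    refine measure_lt_abs_eq_zero_of_moments_le (C := μ₁.real Set.univ) (le_max_right _ _)
      (fun n => hν _) fun n => ?_
    have hμ₂ : 0 ≤ ∫ x, x ^ (2 * n) ∂μ₂ :=
      integral_nonneg fun x => (even_two_mul n).pow_nonneg x
    have hμ₁ : ∫ x, x ^ (2 * n) ∂μ₁ ≤ (max R 0) ^ (2 * n) * μ₁.real Set.univ := by
      refine (Real.le_norm_self _).trans (norm_integral_le_of_norm_le_const (h₁.mono fun x hx => ?_))
      rw [norm_pow]
      exact pow_le_pow_left₀ (abs_nonneg x) hx _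
    linarith [hmom (2 * n)]
  have h₃ : ∀ᵐ x ∂ν, |x| ≤ max R 0 := by
    rw [ae_iff]
    simpa only [not_le] using hν_null
  refine Measure.eq_of_ae_abs_le_of_moments_eq h₁ (ae_add_measure_iff.2 ⟨h₃, h₂⟩) fun n => ?_
  rw [integral_add_measure (hν n) (Continuous.integrable_of_ae_abs_le h₂ (continuous_pow n)),
    ← hmom n, sub_add_cancel]
end

section
/- Let α, q ∈ (-1,1). There exists a finite nonnegative Borel measure ρ on ℝ supported in [0,∞) such that ∫_0^∞ r^{2k} ρ(dr) = (-α;q)_k · [k]_q! for every integer k ≥ 0 if and only if either (i) q ≥ 0 and α ≤ q, or (ii) α = q ≠ 0. -/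
open MeasureTheory

open Filter Topology

/-- `m k` is the `2k`-th moment of some finite measure on `[0,∞)`, for every `k`. -/
def IsEvenMomentSeq (m : ℕ → ℝ) : Prop :=
  ∃ ρ : Measure ℝ, IsFiniteMeasure ρ ∧ ρ (Set.Iio 0) = 0 ∧
    ∀ k : ℕ, Integrable (fun x : ℝ => x ^ (2 * k)) ρ ∧ (∫ x, x ^ (2 * k) ∂ρ) = m k

/-- Multiplicative convolution of measures multiplies the moments. -/
lemma IsEvenMomentSeq.mul {m m' : ℕ → ℝ} (h : IsEvenMomentSeq m) (h' : IsEvenMomentSeq m') :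
    IsEvenMomentSeq (fun k => m k * m' k) := by
  obtain ⟨ρ, hfin, hsupp, hρ⟩ := h
  obtain ⟨ρ', hfin', hsupp', hρ'⟩ := h'
  have hmeas : Measurable (fun z : ℝ × ℝ => z.1 * z.2) := by fun_prop
  refine ⟨(ρ.prod ρ').map (fun z => z.1 * z.2), inferInstance, ?_, fun k => ?_⟩
  · rw [Measure.map_apply hmeas measurableSet_Iio]
    refine measure_mono_null (t := Set.Iio 0 ×ˢ Set.univ ∪ Set.univ ×ˢ Set.Iio 0) ?_ ?_
    · rintro ⟨x, y⟩ hxy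
      simp only [Set.mem_preimage, Set.mem_Iio] at hxy
      by_contra hcon
      simp only [Set.mem_union, Set.mem_prod, Set.mem_Iio, Set.mem_univ, and_true, true_and,
        not_or, not_lt] at hcon
      exact absurd hxy (not_lt.2 (mul_nonneg hcon.1 hcon.2))
    · refine measure_union_null ?_ ?_ <;> simp [Measure.prod_prod, hsupp, hsupp']
  · have hpow : Measurable (fun x : ℝ => x ^ (2 * k)) := by fun_prop
    constructor
    · rw [integrable_map_measure hpow.aestronglyMeasurable hmeas.aemeasurable]
      simpa [Function.comp_def, mul_pow] using (hρ k).1.mul_prod (hρ' k).1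
    · rw [integral_map hmeas.aemeasurable hpow.aestronglyMeasurable]
      simp_rw [mul_pow]
      rw [integral_prod_mul (fun x : ℝ => x ^ (2 * k)) (fun x : ℝ => x ^ (2 * k)),
        (hρ k).2, (hρ' k).2]

lemma isEvenMomentSeq_tsum {c x : ℕ → ℝ} (hc : ∀ n, 0 ≤ c n) (hx : ∀ n, 0 ≤ x n)
    (hs : ∀ k : ℕ, Summable fun n => c n * x n ^ k) :
    IsEvenMomentSeq (fun k => ∑' n, c n * x n ^ k) := by
  have hpow : ∀ k n, Real.sqrt (x n) ^ (2 * k) = x n ^ k := fun k n => by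
    rw [pow_mul, Real.sq_sqrt (hx n)]
  have hint : ∀ k : ℕ, Integrable (fun y : ℝ => y ^ (2 * k))
      (Measure.sum fun n => ENNReal.ofReal (c n) • Measure.dirac (Real.sqrt (x n))) := fun k => by
    refine integrable_sum_dirac (fun _ => ENNReal.ofReal_ne_top) ?_
    refine (hs k).congr fun n => ?_
    rw [hpow, ENNReal.toReal_ofReal (hc n), Real.norm_of_nonneg (pow_nonneg (hx n) k)]
  refine ⟨_, ?_, ?_, fun k => ⟨hint k, ?_⟩⟩
  · simpa [integrable_const_iff] using hint 0
  · simp [Measure.sum_apply, measurableSet_Iio, Real.sqrt_nonneg]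
  · rw [integral_sum_dirac fun _ => ENNReal.ofReal_ne_top]
    refine tsum_congr fun n => ?_
    rw [hpow, ENNReal.toReal_ofReal (hc n), smul_eq_mul]

lemma isEvenMomentSeq_const_pow {c : ℝ} (hc : 0 ≤ c) : IsEvenMomentSeq (fun k => c ^ k) := by
  refine ⟨Measure.dirac (Real.sqrt c), inferInstance, ?_, fun k => ⟨?_, ?_⟩⟩
  · simp [Real.sqrt_nonneg]
  · exact integrable_dirac (by simp)
  · rw [integral_dirac, pow_mul, Real.sq_sqrt hc]

/-- The coefficients of the power series `(B x;q)_∞ / (A x;q)_∞`. -/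
noncomputable def qBinomCoeff (A B q : ℝ) (n : ℕ) : ℝ :=
  ∏ i ∈ Finset.range n, (A - B * q ^ i) / (1 - q ^ (i + 1))

section QBinomial

variable {A B q : ℝ}

lemma one_sub_pow_succ_pos_s12 (hq0 : 0 ≤ q) (hq1 : q < 1) (n : ℕ) : 0 < 1 - q ^ (n + 1) :=
  sub_pos.2 (pow_lt_one₀ hq0 hq1 n.succ_ne_zero)

lemma qBinomCoeff_succ_mul (hq0 : 0 ≤ q) (hq1 : q < 1) (n : ℕ) :
    qBinomCoeff A B q (n + 1) * (1 - q ^ (n + 1)) = (A - B * q ^ n) * qBinomCoeff A B q n := by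
  have := (one_sub_pow_succ_pos_s12 hq0 hq1 n).ne'
  rw [qBinomCoeff, Finset.prod_range_succ, ← qBinomCoeff]
  field_simp

lemma sub_mul_pow_nonneg (hq0 : 0 ≤ q) (hq1 : q < 1) (hA : 0 ≤ A) (hBA : B ≤ A) (n : ℕ) :
    0 ≤ A - B * q ^ n := by
  have h0 : 0 ≤ q ^ n := pow_nonneg hq0 n
  have h1 : q ^ n ≤ 1 := pow_le_one₀ hq0 hq1.le
  nlinarith

lemma qBinomCoeff_nonneg (hq0 : 0 ≤ q) (hq1 : q < 1) (hA : 0 ≤ A) (hBA : B ≤ A) (n : ℕ) :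
    0 ≤ qBinomCoeff A B q n :=
  Finset.prod_nonneg fun i _ =>
    div_nonneg (sub_mul_pow_nonneg hq0 hq1 hA hBA i) (one_sub_pow_succ_pos_s12 hq0 hq1 i).le

lemma summable_qBinomCoeff (hq0 : 0 ≤ q) (hq1 : q < 1) (hA : 0 ≤ A) (hA1 : A < 1) (hBA : B ≤ A) :
    Summable (qBinomCoeff A B q) := by
  have hlim : Tendsto (fun n : ℕ => (A - B * q ^ n) / (1 - q ^ (n + 1))) atTop (𝓝 A) := by
    have h := tendsto_pow_atTop_nhds_zero_of_lt_one hq0 hq1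
    have h' := h.comp (tendsto_add_atTop_nat 1)
    simpa [Pi.div_def] using ((h.const_mul B).const_sub A).div (h'.const_sub 1) (by norm_num)
  obtain ⟨r, hAr, hr⟩ := exists_between hA1
  refine summable_of_ratio_norm_eventually_le hr ?_
  filter_upwards [hlim.eventually_le_const hAr] with n hn
  rw [Real.norm_of_nonneg (qBinomCoeff_nonneg hq0 hq1 hA hBA _),
    Real.norm_of_nonneg (qBinomCoeff_nonneg hq0 hq1 hA hBA _), qBinomCoeff,
    Finset.prod_range_succ, ← qBinomCoeff, mul_comm]
  exact mul_le_mul_of_nonneg_right hn (qBinomCoeff_nonneg hq0 hq1 hA hBA _)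

lemma summable_qBinomCoeff_mul_pow (hq0 : 0 ≤ q) (hq1 : q < 1) (hA : 0 ≤ A) (hA1 : A < 1)
    (hBA : B ≤ A) {x : ℝ} (hx0 : 0 ≤ x) (hx1 : x ≤ 1) :
    Summable fun n => qBinomCoeff A B q n * x ^ n :=
  Summable.of_nonneg_of_le
    (fun n => mul_nonneg (qBinomCoeff_nonneg hq0 hq1 hA hBA n) (pow_nonneg hx0 n))
    (fun n => mul_le_of_le_one_right (qBinomCoeff_nonneg hq0 hq1 hA hBA n) (pow_le_one₀ hx0 hx1))
    (summable_qBinomCoeff hq0 hq1 hA hA1 hBA)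

/-- The `q`-difference equation of the `q`-binomial series. -/
lemma tsum_qBinomCoeff_mul (hq0 : 0 ≤ q) (hq1 : q < 1) (hA : 0 ≤ A) (hA1 : A < 1)
    (hBA : B ≤ A) {x : ℝ} (hx0 : 0 ≤ x) (hx1 : x ≤ 1) :
    (1 - B * x) * ∑' n, qBinomCoeff A B q n * (q * x) ^ n =
      (1 - A * x) * ∑' n, qBinomCoeff A B q n * x ^ n := by
  have hs := summable_qBinomCoeff_mul_pow hq0 hq1 hA hA1 hBA hx0 hx1
  have hs' := summable_qBinomCoeff_mul_pow hq0 hq1 hA hA1 hBA (mul_nonneg hq0 hx0)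
    (mul_le_one₀ hq1.le hx0 hx1)
  have hdiff : (∑' n, qBinomCoeff A B q n * x ^ n) - ∑' n, qBinomCoeff A B q n * (q * x) ^ n =
      A * x * (∑' n, qBinomCoeff A B q n * x ^ n) -
        B * x * ∑' n, qBinomCoeff A B q n * (q * x) ^ n := by
    rw [← hs.tsum_sub hs', ← tsum_mul_left, ← tsum_mul_left,
      ← (hs.mul_left _).tsum_sub (hs'.mul_left _), (hs.sub hs').tsum_eq_zero_add]
    simp only [pow_zero, sub_self, zero_add]
    refine tsum_congr fun n => ?_
    have h := qBinomCoeff_succ_mul (A := A) (B := B) hq0 hq1 n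
    rw [mul_pow, mul_pow]
    linear_combination x ^ (n + 1) * h
  linarith

lemma isEvenMomentSeq_prod_div (hq0 : 0 ≤ q) (hq1 : q < 1) (hA : 0 ≤ A) (hA1 : A < 1)
    (hBA : B ≤ A) :
    IsEvenMomentSeq
      (fun k => ∏ i ∈ Finset.range k, (1 - A * q ^ i) / (1 - B * q ^ i)) := by
  set S : ℝ := ∑' n, qBinomCoeff A B q n with hS
  have hpow : ∀ k n : ℕ, (q ^ n) ^ k = (q ^ k) ^ n := fun k n => by
    rw [← pow_mul, ← pow_mul, mul_comm]
  have hsum : ∀ k : ℕ, Summable fun n => qBinomCoeff A B q n * (q ^ k) ^ n := fun k =>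
    summable_qBinomCoeff_mul_pow hq0 hq1 hA hA1 hBA (pow_nonneg hq0 k) (pow_le_one₀ hq0 hq1.le)
  have hSpos : 0 < S :=
    (summable_qBinomCoeff hq0 hq1 hA hA1 hBA).tsum_pos (qBinomCoeff_nonneg hq0 hq1 hA hBA) 0
      (by simp [qBinomCoeff])
  have h := isEvenMomentSeq_tsum (c := fun n => S⁻¹ * qBinomCoeff A B q n) (x := fun n => q ^ n)
    (fun n => mul_nonneg (inv_nonneg.2 hSpos.le) (qBinomCoeff_nonneg hq0 hq1 hA hBA n))
    (fun n => pow_nonneg hq0 n)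
    (fun k => by simpa only [hpow, mul_assoc] using (hsum k).mul_left S⁻¹)
  convert h using 1
  funext k
  simp only [hpow, mul_assoc, tsum_mul_left]
  induction k with
  | zero => simp [← hS, hSpos.ne']
  | succ k ih =>
    have hq1' : q ^ k ≤ 1 := pow_le_one₀ hq0 hq1.le
    have hB : 1 - B * q ^ k ≠ 0 := by
      have := pow_nonneg hq0 k
      refine (sub_pos.2 ?_).ne'
      nlinarith
    have hfun := tsum_qBinomCoeff_mul hq0 hq1 hA hA1 hBA (pow_nonneg hq0 k) hq1'
    rw [Finset.prod_range_succ, ih, pow_succ', mul_div_assoc', div_eq_iff hB]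
    linear_combination -S⁻¹ * hfun

end QBinomial

lemma qPoch_mul_qFact (α q : ℝ) (k : ℕ) :
    qPoch (-α) q k * qFact q k =
      ∏ i ∈ Finset.range k, (1 + α * q ^ i) * ∑ j ∈ Finset.range (i + 1), q ^ j := by
  simp [qPoch, qFact, Finset.prod_mul_distrib]

lemma isEvenMomentSeq_of_prod_eq {α q A B p A' B' p' : ℝ} (hq : q < 1)
    (h : IsEvenMomentSeq (fun k => ∏ i ∈ Finset.range k, (1 - A * p ^ i) / (1 - B * p ^ i)))
    (h' : IsEvenMomentSeq
      (fun k => ∏ i ∈ Finset.range k, (1 - A' * p' ^ i) / (1 - B' * p' ^ i)))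
    (heq : ∀ i : ℕ, (1 - A * p ^ i) / (1 - B * p ^ i) * ((1 - A' * p' ^ i) / (1 - B' * p' ^ i)) =
      (1 + α * q ^ i) * (1 - q ^ (i + 1))) :
    IsEvenMomentSeq (fun k => qPoch (-α) q k * qFact q k) := by
  have hq' : 0 < 1 - q := sub_pos.2 hq
  convert (h.mul h').mul (isEvenMomentSeq_const_pow (inv_nonneg.2 hq'.le)) using 1
  funext k
  rw [qPoch_mul_qFact, ← Finset.prod_mul_distrib, Finset.pow_eq_prod_const,
    ← Finset.prod_mul_distrib]
  refine Finset.prod_congr rfl fun i _ => ?_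
  rw [heq, geom_sum_eq hq.ne, ← neg_div_neg_eq]
  ring

lemma isEvenMomentSeq_qPoch_mul_qFact {α q : ℝ} (hα : α ∈ Set.Ioo (-1 : ℝ) 1)
    (hq : q ∈ Set.Ioo (-1 : ℝ) 1) (h : (0 ≤ q ∧ α ≤ q) ∨ (α = q ∧ q ≠ 0)) :
    IsEvenMomentSeq (fun k => qPoch (-α) q k * qFact q k) := by
  obtain ⟨hα0, hα1⟩ := hα
  obtain ⟨hq0, hq1⟩ := hq
  have hqsq : q ^ 2 < 1 := by nlinarith
  rcases h with ⟨hq, hle⟩ | ⟨rfl, -⟩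
  · rcases le_or_gt α 0 with hα | hα
    · refine isEvenMomentSeq_of_prod_eq hq1
        (isEvenMomentSeq_prod_div (A := -α) (B := 0) hq hq1 (by linarith) (by linarith)
          (by linarith))
        (isEvenMomentSeq_prod_div (A := q) (B := 0) hq hq1 hq hq1 hq) fun i => ?_
      simp [pow_succ']
    · refine isEvenMomentSeq_of_prod_eq hq1
        (isEvenMomentSeq_prod_div (A := α ^ 2) (B := 0) (q := q ^ 2) (by positivity) hqsq
          (by positivity) (by nlinarith) (by positivity))
        (isEvenMomentSeq_prod_div (A := q) (B := α) hq hq1 hq hq1 hle) fun i => ?_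
      have : 1 - α * q ^ i ≠ 0 := by
        have h0 := pow_nonneg hq i
        have h1 : q ^ i ≤ 1 := pow_le_one₀ hq hq1.le
        refine (sub_pos.2 ?_).ne'
        nlinarith
      simp only [zero_mul, sub_zero, div_one]
      rw [mul_div_assoc', div_eq_iff this]
      ring
  · refine isEvenMomentSeq_of_prod_eq hq1
      (isEvenMomentSeq_prod_div (A := α ^ 2) (B := 0) (q := α ^ 2) (by positivity) hqsq
        (by positivity) hqsq (by positivity))
      (isEvenMomentSeq_prod_div (A := 0) (B := 0) (q := 0) le_rfl one_pos le_rfl one_pos le_rfl)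
      fun i => ?_
    simp only [zero_mul, sub_zero, div_one, mul_one]
    ring

lemma IsEvenMomentSeq.quadratic_nonneg {m : ℕ → ℝ} (h : IsEvenMomentSeq m) (t : ℝ) (k : ℕ) :
    0 ≤ m (k + 2) - 2 * t * m (k + 1) + t ^ 2 * m k := by
  obtain ⟨ρ, -, -, hρ⟩ := h
  have hint : ∫ x, x ^ (2 * k) * (x ^ 2 - t) ^ 2 ∂ρ =
      m (k + 2) - 2 * t * m (k + 1) + t ^ 2 * m k := by
    have h1 := (hρ (k + 1)).1.const_mul (2 * t)
    have h2 := (hρ k).1.const_mul (t ^ 2)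
    rw [← (hρ k).2, ← (hρ (k + 1)).2, ← (hρ (k + 2)).2, ← integral_const_mul,
      ← integral_const_mul, ← integral_sub (hρ (k + 2)).1 h1,
      ← integral_add (f := fun x => x ^ (2 * (k + 2)) - 2 * t * x ^ (2 * (k + 1)))
        ((hρ (k + 2)).1.sub h1) h2]
    refine integral_congr_ae (.of_forall fun x => ?_)
    ring
  rw [← hint]
  exact integral_nonneg fun x => mul_nonneg (by rw [pow_mul]; positivity) (sq_nonneg _)

/-- Cauchy–Schwarz makes the ratios of consecutive even moments nondecreasing. -/
lemma IsEvenMomentSeq.monotone_ratio {r : ℕ → ℝ} (hr : ∀ i, 0 < r i)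
    (h : IsEvenMomentSeq (fun k => ∏ i ∈ Finset.range k, r i)) : Monotone r := by
  refine monotone_nat_of_le_succ fun k => ?_
  have hk := h.quadratic_nonneg (r k) k
  simp only [Finset.prod_range_succ] at hk
  have hpos : 0 < (∏ i ∈ Finset.range k, r i) * r k :=
    mul_pos (Finset.prod_pos fun i _ => hr i) (hr k)
  have : 0 ≤ ((∏ i ∈ Finset.range k, r i) * r k) * (r (k + 1) - r k) := by linarith
  exact sub_nonneg.1 (nonneg_of_mul_nonneg_right this hpos)

lemma sub_mul_pow_le_of_isEvenMomentSeq {α q : ℝ} (hα : α ∈ Set.Ioo (-1 : ℝ) 1)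
    (hq : q ∈ Set.Ioo (-1 : ℝ) 1)
    (h : IsEvenMomentSeq (fun k => qPoch (-α) q k * qFact q k)) (k : ℕ) :
    (α - q) * q ^ k ≤ α * q ^ (2 * k + 1) := by
  have hα' : |α| < 1 := abs_lt.2 hα
  have hq' : |q| < 1 := abs_lt.2 hq
  have hq1 : 0 < 1 - q := sub_pos.2 hq.2
  set r : ℕ → ℝ := fun i => (1 + α * q ^ i) * ((1 - q ^ (i + 1)) / (1 - q)) with hr
  have hrpos : ∀ i, 0 < r i := fun i => by
    have h1 : |α * q ^ i| < 1 := by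
      rw [abs_mul, abs_pow]
      exact mul_lt_one_of_nonneg_of_lt_one_left (abs_nonneg _) hα'
        (pow_le_one₀ (abs_nonneg _) hq'.le)
    have h2 : |q ^ (i + 1)| < 1 := by
      rw [abs_pow]
      exact pow_lt_one₀ (abs_nonneg _) hq' i.succ_ne_zero
    have h1' := (abs_lt.1 h1).1
    have h2' := (abs_lt.1 h2).2
    exact mul_pos (by linarith) (div_pos (by linarith) hq1)
  have hmono : Monotone r := by
    refine IsEvenMomentSeq.monotone_ratio hrpos ?_
    convert h using 2 with k
    rw [qPoch_mul_qFact]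
    refine Finset.prod_congr rfl fun i _ => ?_
    rw [geom_sum_eq hq.2.ne, ← neg_div_neg_eq (q ^ (i + 1) - 1)]
    simp [hr]
  have hlim : Tendsto r atTop (𝓝 (1 / (1 - q))) := by
    have h := tendsto_pow_atTop_nhds_zero_of_abs_lt_one hq'
    have h' := h.comp (tendsto_add_atTop_nat 1)
    simpa using ((h.const_mul α).const_add 1).mul ((h'.const_sub 1).div_const (1 - q))
  have hk := hmono.ge_of_tendsto hlim k
  rw [hr] at hk
  simp only [mul_div_assoc'] at hk
  rw [div_le_div_iff_of_pos_right hq1] at hk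
  have : α * q ^ (2 * k + 1) = α * q ^ k * q ^ (k + 1) := by ring
  rw [this]
  linarith [pow_succ' q k]

/-- Main theorem: `ν_{α,q}` has a radial Bargmann representation (a finite
nonnegative measure on `[0,∞)` whose (2k)-th moments are `(-α;q)_k [k]_q!`)
if and only if (i) `q ≥ 0` and `α ≤ q`, or (ii) `α = q ≠ 0`. -/
theorem radial_bargmann_exists_iff (α q : ℝ) (hα : α ∈ Set.Ioo (-1 : ℝ) 1)
    (hq : q ∈ Set.Ioo (-1 : ℝ) 1) :
    (∃ ρ : Measure ℝ, IsFiniteMeasure ρ ∧ ρ (Set.Iio 0) = 0 ∧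
      ∀ k : ℕ, Integrable (fun x : ℝ => x ^ (2 * k)) ρ ∧
        (∫ x, x ^ (2 * k) ∂ρ) = qPoch (-α) q k * qFact q k)
    ↔ ((0 ≤ q ∧ α ≤ q) ∨ (α = q ∧ q ≠ 0)) := by
  refine ⟨fun h => ?_, isEvenMomentSeq_qPoch_mul_qFact hα hq⟩
  have hle := sub_mul_pow_le_of_isEvenMomentSeq hα hq h
  have hq' : |q| < 1 := abs_lt.2 hq
  have hpow := tendsto_pow_atTop_nhds_zero_of_abs_lt_one hq'
  have hαq : α ≤ q := by
    rcases eq_or_ne q 0 with rfl | hq0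
    · simpa using hle 0
    · have hlim : Tendsto (fun j : ℕ => α * q ^ (2 * j + 1)) atTop (𝓝 0) := by
        have hj : Tendsto (fun j : ℕ => 2 * j + 1) atTop atTop :=
          tendsto_atTop_mono (fun j => by simp only [id]; omega) tendsto_id
        simpa using (hpow.comp hj).const_mul α
      refine sub_nonpos.1 (ge_of_tendsto' hlim fun j => ?_)
      have hpos : 0 < q ^ (2 * j) := by rw [pow_mul]; positivity
      refine le_of_mul_le_mul_right ((hle (2 * j)).trans_eq ?_) hpos
      ring
  rcases le_or_gt 0 q with hq0 | hq0
  · exact Or.inl ⟨hq0, hαq⟩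
  · refine Or.inr ⟨le_antisymm hαq ?_, hq0.ne⟩
    have hlim : Tendsto (fun j : ℕ => α * q ^ (2 * j + 2)) atTop (𝓝 0) := by
      have hj : Tendsto (fun j : ℕ => 2 * j + 2) atTop atTop :=
        tendsto_atTop_mono (fun j => by simp only [id]; omega) tendsto_id
      simpa using (hpow.comp hj).const_mul α
    refine sub_nonneg.1 (le_of_tendsto' hlim fun j => ?_)
    have hneg : q ^ (2 * j + 1) < 0 := (Odd.pow_neg_iff ⟨j, rfl⟩).2 hq0
    refine (mul_le_mul_right_of_neg hneg).1 ?_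
    refine (hle (2 * j + 1)).trans_eq ?_
    ring
end

section
/- Let α, q ∈ (-1,1) with q ≠ 0. For every function f : ℂ → ℂ and every z ∈ ℂ with z ≠ 0, the q-commutation relation [a⁻, a⁺]_q = M_{α,q} holds pointwise: D_{α,q}(w ↦ w·f(w))(z) - q·z·(D_{α,q} f)(z) = f(z) + α·f(q² z). -/
/-- The α-deformed Jackson derivative (for `z ≠ 0`):
`(D_{α,q} f)(z) = (f(z)-f(qz))/((1-q)z) + α (f(q²z)-f(qz))/((q²-q)z)`. -/
noncomputable def Daq (α q : ℝ) (f : ℂ → ℂ) (z : ℂ) : ℂ :=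
  (f z - f ((q : ℂ) * z)) / ((1 - (q : ℂ)) * z)
    + (α : ℂ) * ((f ((q : ℂ) ^ 2 * z) - f ((q : ℂ) * z)) / (((q : ℂ) ^ 2 - (q : ℂ)) * z))

/-- The q-commutation relation `[a⁻,a⁺]_q = M_{α,q}` holds pointwise:
`D_{α,q}(w ↦ w f(w))(z) - q z (D_{α,q} f)(z) = f(z) + α f(q² z)`. -/
theorem q_commutation (α q : ℝ) (hα : α ∈ Set.Ioo (-1 : ℝ) 1)
    (hq : q ∈ Set.Ioo (-1 : ℝ) 1) (hq0 : q ≠ 0)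
    (f : ℂ → ℂ) (z : ℂ) (hz : z ≠ 0) :
    Daq α q (fun w => w * f w) z - (q : ℂ) * z * Daq α q f z
      = f z + (α : ℂ) * f ((q : ℂ) ^ 2 * z) := by
  have hq0' : (q : ℂ) ≠ 0 := Complex.ofReal_ne_zero.mpr hq0
  have h1 : 1 - (q : ℂ) ≠ 0 :=
    sub_ne_zero.mpr fun h => hq.2.ne' (Complex.ofReal_injective (by simpa using h))
  have h2 : (q : ℂ) ^ 2 - q ≠ 0 := by
    rw [show (q : ℂ) ^ 2 - q = -(q * (1 - q)) by ring]
    exact neg_ne_zero.mpr (mul_ne_zero hq0' h1)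
  simp only [Daq]
  generalize f ((q : ℂ) ^ 2 * z) = f₂
  generalize f ((q : ℂ) * z) = f₁
  have e1 : (z * f z - q * z * f₁) / ((1 - q) * z)
      - q * z * ((f z - f₁) / ((1 - q) * z)) = f z := by
    rw [← mul_div_assoc, ← sub_div, div_eq_iff (mul_ne_zero h1 hz)]
    ring
  have e2 : ((q : ℂ) ^ 2 * z * f₂ - q * z * f₁) / (((q : ℂ) ^ 2 - q) * z)
      - q * z * ((f₂ - f₁) / (((q : ℂ) ^ 2 - q) * z)) = f₂ := by
    rw [← mul_div_assoc, ← sub_div, div_eq_iff (mul_ne_zero h2 hz)]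
    ring
  linear_combination e1 + (α : ℂ) * e2
end

section
/- Let α, q ∈ (-1,1) with q ≠ 0, and define (M f)(z) = f(z) + α·f(q² z). Then for every function f : ℂ → ℂ and every z ∈ ℂ with z ≠ 0 the q²-commutation relations [a⁻, M]_{q²} = (1-q²) a⁻ and [M, a⁺]_{q²} = (1-q²) a⁺ hold pointwise: D_{α,q}(M f)(z) - q²·(M (D_{α,q} f))(z) = (1-q²)·(D_{α,q} f)(z), and M(w ↦ w·f(w))(z) - q²·z·(M f)(z) = (1-q²)·z·f(z). -/
theorem Daq_add_smul (α q : ℝ) (c : ℂ) (f g : ℂ → ℂ) (z : ℂ) :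
    Daq α q (fun w => f w + c * g w) z = Daq α q f z + c * Daq α q g z := by
  simp only [Daq]
  ring

theorem Daq_comp_mul_left (α q : ℝ) {c : ℂ} (hc : c ≠ 0) (f : ℂ → ℂ) (z : ℂ) :
    Daq α q (fun w => f (c * w)) z = c * Daq α q f (c * z) := by
  have h (a b : ℂ) : a / (b * z) = c * (a / (b * (c * z))) := by
    rw [mul_left_comm b c z, ← mul_div_assoc, mul_div_mul_left _ _ hc]
  simp only [Daq]
  rw [h, h _ ((q : ℂ) ^ 2 - q), mul_left_comm c (q : ℂ) z, mul_left_comm c ((q : ℂ) ^ 2) z]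
  ring

/-- The q²-commutation relations `[a⁻,M]_{q²} = (1-q²)a⁻` and
`[M,a⁺]_{q²} = (1-q²)a⁺` hold pointwise, where `(Mf)(z) = f(z) + α f(q²z)`. -/
theorem q_sq_commutations (α q : ℝ) (hα : α ∈ Set.Ioo (-1 : ℝ) 1)
    (hq : q ∈ Set.Ioo (-1 : ℝ) 1) (hq0 : q ≠ 0)
    (f : ℂ → ℂ) (z : ℂ) (hz : z ≠ 0) :
    (Daq α q (fun w => f w + (α : ℂ) * f ((q : ℂ) ^ 2 * w)) z
        - (q : ℂ) ^ 2 * (Daq α q f z + (α : ℂ) * Daq α q f ((q : ℂ) ^ 2 * z))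
      = (1 - (q : ℂ) ^ 2) * Daq α q f z) ∧
    ((z * f z + (α : ℂ) * ((q : ℂ) ^ 2 * z * f ((q : ℂ) ^ 2 * z)))
        - (q : ℂ) ^ 2 * z * (f z + (α : ℂ) * f ((q : ℂ) ^ 2 * z))
      = (1 - (q : ℂ) ^ 2) * z * f z) := by
  have hq2 : (q : ℂ) ^ 2 ≠ 0 := pow_ne_zero 2 (Complex.ofReal_ne_zero.mpr hq0)
  constructor
  · rw [Daq_add_smul α q α f (fun w => f ((q : ℂ) ^ 2 * w)), Daq_comp_mul_left α q hq2]
    ring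
  · ring
end

section
/- Let q ∈ (-1,1) with q ≠ 0 and take α = q. Then for every function f : ℂ → ℂ and every z ∈ ℂ with z ≠ 0, the refined q²-commutation relation [a⁻, a⁺]_{q²} = (1+q)·I holds pointwise: D_{q,q}(w ↦ w·f(w))(z) - q²·z·(D_{q,q} f)(z) = (1+q)·f(z). -/
/-- For `α = q`, the refined q²-commutation relation `[a⁻,a⁺]_{q²} = (1+q)I`
holds pointwise: `D_{q,q}(w ↦ w f(w))(z) - q² z (D_{q,q} f)(z) = (1+q) f(z)`. -/
theorem q_sq_commutation_alpha_eq_q (q : ℝ) (hq : q ∈ Set.Ioo (-1 : ℝ) 1) (hq0 : q ≠ 0)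
    (f : ℂ → ℂ) (z : ℂ) (hz : z ≠ 0) :
    Daq q q (fun w => w * f w) z - (q : ℂ) ^ 2 * z * Daq q q f z
      = (1 + (q : ℂ)) * f z := by
  have hq1 : (1 : ℂ) - q ≠ 0 := by
    rw [sub_ne_zero]
    exact_mod_cast hq.2.ne'
  have hqc : (q : ℂ) ≠ 0 := by exact_mod_cast hq0
  have h_jackson (g : ℂ → ℂ) :
      Daq q q g z = (g z - g ((q : ℂ) ^ 2 * z)) / ((1 - (q : ℂ)) * z) := by
    have hden : (q : ℂ) ^ 2 - q = -(q * (1 - q)) := by ring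
    rw [Daq, hden]
    field_simp
    ring
  rw [h_jackson, h_jackson]
  field_simp
  ring
end
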